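/- arXiv:math/0508146 — 3 statements merged into one kernel-verified Lean document; each statement's English description precedes it below -/
import Mathlib

section
/- Let G be a subgroup of the Baer–Specker group ℤ^ℕ. The following are equivalent: (1) G is Scheepers-bounded; (2) for each strictly increasing h : ℕ → ℕ there is f : ℕ → ℕ such that for every finite set F ⊆ G there exists n with |g(i)| ≤ f(n) for all g ∈ F and all i < h(n); (3) for each strictly increasing h : ℕ → ℕ there is f : ℕ → ℕ such that for every finite set F ⊆ G there exists n with g(i) ≤ f(n) for all g ∈ F and all i < h(n); (4) there is f : ℕ → ℕ such that for every finite set F ⊆ G there exist infinitely many n with |g(i)| ≤ f(n) for all g ∈ F and all i < n; (5) there is f : ℕ → ℕ such that for every finite set F ⊆ G there exist infinitely many n with g(i) ≤ f(n) for all g ∈ F and all i < n. Moreover, in (2) and (3) the quantifier 'there exists n' may be replaced by 'there exist infinitely many n'. -/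
open Filter Set Topology Pointwise

def MengerBounded (G : Type*) [AddGroup G] [TopologicalSpace G] : Prop :=
  ∀ U : ℕ → Set G, (∀ n, U n ∈ nhds (0 : G)) →
    ∃ F : ℕ → Finset G, ∀ g : G, ∃ n, g ∈ (F n : Set G) + U n

def ScheepersBounded (G : Type*) [AddGroup G] [TopologicalSpace G] : Prop :=
  ∀ U : ℕ → Set G, (∀ n, U n ∈ nhds (0 : G)) →
    ∃ F : ℕ → Finset G, ∀ E : Finset G, ∃ n, (E : Set G) ⊆ (F n : Set G) + U n

def HurewiczBounded (G : Type*) [AddGroup G] [TopologicalSpace G] : Prop :=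
  ∀ U : ℕ → Set G, (∀ n, U n ∈ nhds (0 : G)) →
    ∃ F : ℕ → Finset G, ∀ g : G, ∀ᶠ n in atTop, g ∈ (F n : Set G) + U n

def RothbergerBounded (G : Type*) [AddGroup G] [TopologicalSpace G] : Prop :=
  ∀ U : ℕ → Set G, (∀ n, U n ∈ nhds (0 : G)) →
    ∃ a : ℕ → G, ∀ g : G, ∃ n, g ∈ ({a n} : Set G) + U n

def HasMenger (X : Type*) [TopologicalSpace X] : Prop :=
  ∀ U : ℕ → Set (Set X), (∀ n, ∀ u ∈ U n, IsOpen u) → (∀ n, ⋃₀ U n = univ) →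
    ∃ F : ℕ → Set (Set X), (∀ n, (F n).Finite ∧ F n ⊆ U n) ∧ ⋃ n, ⋃₀ F n = univ

def HasScheepers (X : Type*) [TopologicalSpace X] : Prop :=
  ∀ U : ℕ → Set (Set X), (∀ n, ∀ u ∈ U n, IsOpen u) → (∀ n, ⋃₀ U n = univ) →
    ∃ F : ℕ → Set (Set X), (∀ n, (F n).Finite ∧ F n ⊆ U n) ∧
      ∀ E : Set X, E.Finite → ∃ n, E ⊆ ⋃₀ F n

def HasHurewicz (X : Type*) [TopologicalSpace X] : Prop :=
  ∀ U : ℕ → Set (Set X), (∀ n, ∀ u ∈ U n, IsOpen u) → (∀ n, ⋃₀ U n = univ) →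
    ∃ F : ℕ → Set (Set X), (∀ n, (F n).Finite ∧ F n ⊆ U n) ∧
      ∀ x : X, ∀ᶠ n in atTop, x ∈ ⋃₀ F n

def HasRothberger (X : Type*) [TopologicalSpace X] : Prop :=
  ∀ U : ℕ → Set (Set X), (∀ n, ∀ u ∈ U n, IsOpen u) → (∀ n, ⋃₀ U n = univ) →
    ∃ u : ℕ → Set X, (∀ n, u n ∈ U n) ∧ ⋃ n, u n = univ

def MengerBddSet (Y : Set (ℕ → ℤ)) : Prop :=
  ∃ f : ℕ → ℕ, ∀ y ∈ Y, ∃ᶠ n in atTop, ∀ i < n, |y i| ≤ (f n : ℤ)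

def ScheepersBddSet (Y : Set (ℕ → ℤ)) : Prop :=
  ∃ f : ℕ → ℕ, ∀ F : Finset (ℕ → ℤ), (F : Set (ℕ → ℤ)) ⊆ Y →
    ∃ᶠ n in atTop, ∀ y ∈ F, ∀ i < n, y i ≤ (f n : ℤ)

def HurewiczBddSet (Y : Set (ℕ → ℤ)) : Prop :=
  ∃ f : ℕ → ℕ, ∀ y ∈ Y, ∀ᶠ n in atTop, |y n| ≤ (f n : ℤ)

def RothbergerBddSet (Y : Set (ℕ → ℤ)) : Prop :=
  ∀ h : ℕ → ℕ, StrictMono h → ∃ φ : (n : ℕ) → Fin (h n) → ℤ,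
    ∀ y ∈ Y, ∃ n, ∀ i : Fin (h n), y i.val = φ n i

noncomputable def frakb : Cardinal :=
  sInf {c : Cardinal | ∃ B : Set (ℕ → ℕ),
    (∀ g : ℕ → ℕ, ∃ f ∈ B, ¬ ∀ᶠ n in atTop, f n ≤ g n) ∧ Cardinal.mk ↥B = c}

noncomputable def frakd : Cardinal :=
  sInf {c : Cardinal | ∃ D : Set (ℕ → ℕ),
    (∀ g : ℕ → ℕ, ∃ f ∈ D, ∀ᶠ n in atTop, g n ≤ f n) ∧ Cardinal.mk ↥D = c}

noncomputable def covMeager : Cardinal :=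
  sInf {c : Cardinal | ∃ Y : Set (ℕ → ℕ),
    (¬ ∃ f : ℕ → ℕ, ∀ y ∈ Y, ∃ n, f n = y n) ∧ Cardinal.mk ↥Y = c}

open Classical in
noncomputable def specDist (x y : ℕ → ℤ) : ℝ :=
  if x = y then 0 else 1 / (((sInf {n | x n ≠ y n} : ℕ) : ℝ) + 1)

def HasSMZ (S : Set (ℕ → ℤ)) : Prop :=
  ∀ ε : ℕ → ℝ, (∀ n, 0 < ε n) →
    ∃ U : ℕ → Set (ℕ → ℤ), S ⊆ ⋃ n, U n ∧
      ∀ n, ∀ x ∈ U n, ∀ y ∈ U n, specDist x y < ε n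

def HurewiczBoundedMul (G : Type*) [Group G] [TopologicalSpace G] : Prop :=
  ∀ U : ℕ → Set G, (∀ n, U n ∈ nhds (1 : G)) →
    ∃ F : ℕ → Finset G, ∀ g : G, ∀ᶠ n in atTop, g ∈ (F n : Set G) * U n

def LeftTotallyBounded {G : Type*} [Group G] [TopologicalSpace G] (B : Set G) : Prop :=
  ∀ U ∈ nhds (1 : G), ∃ F : Finset G, B ⊆ (F : Set G) * U

def TotallyBoundedIn {G : Type*} [Group G] [TopologicalSpace G] (B : Set G) : Prop :=
  ∀ U ∈ nhds (1 : G), ∃ F : Finset G, B ⊆ ((F : Set G) * U) ∩ (U * (F : Set G))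

/-- Over a subgroup, one-sided bounds on a larger finite set yield two-sided bounds. -/
lemma AddSubgroup.exists_finset_abs_le_of_le (G : AddSubgroup (ℕ → ℤ)) (F : Finset (ℕ → ℤ))
    (hF : (F : Set (ℕ → ℤ)) ⊆ G) :
    ∃ F' : Finset (ℕ → ℤ), (F' : Set (ℕ → ℤ)) ⊆ G ∧ ∀ (N : ℕ) (c : ℤ),
      (∀ g ∈ F', ∀ i < N, g i ≤ c) → ∀ g ∈ F, ∀ i < N, |g i| ≤ c := by
  classical
  refine ⟨F ∪ F.image (fun g => -g), ?_, ?_⟩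
  · intro g hg
    simp only [Finset.coe_union, Finset.coe_image, Set.mem_union, Set.mem_image] at hg
    rcases hg with hg | ⟨a, ha, rfl⟩
    · exact hF hg
    · exact G.neg_mem (hF ha)
  · intro N c h g hg i hi
    have h1 := h g (Finset.mem_union_left _ hg) i hi
    have h2 := h (-g) (Finset.mem_union_right _ (Finset.mem_image_of_mem _ hg)) i hi
    rw [Pi.neg_apply] at h2
    exact abs_le.2 ⟨by omega, h1⟩

/-- The elements vanishing on an initial segment form a neighborhood of zero. -/
lemma AddSubgroup.vanishing_mem_nhds_zero (G : AddSubgroup (ℕ → ℤ)) (m : ℕ) :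
    {g : G | ∀ i < m, (g : ℕ → ℤ) i = 0} ∈ nhds (0 : G) := by
  have key : ∀ᶠ g : G in nhds 0, ∀ i ∈ Set.Iio m, (g : ℕ → ℤ) i = 0 := by
    refine (eventually_all_finite (Set.finite_Iio m)).2 fun i _ => ?_
    have hc : Continuous fun g : G => (g : ℕ → ℤ) i :=
      (continuous_apply i).comp continuous_subtype_val
    exact (isOpen_discrete ({0} : Set ℤ)).preimage hc |>.mem_nhds (by simp)
  exact key

/-- Every neighborhood of zero contains all elements vanishing on some initial segment. -/
lemma AddSubgroup.exists_vanishing_subset (G : AddSubgroup (ℕ → ℤ)) {U : Set G}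
    (hU : U ∈ nhds (0 : G)) :
    ∃ m : ℕ, {g : G | ∀ i < m, (g : ℕ → ℤ) i = 0} ⊆ U := by
  obtain ⟨u, hu, huU⟩ := (mem_nhds_subtype _ _ _).1 hU
  rw [nhds_pi, Filter.mem_pi] at hu
  obtain ⟨I, hI, t, ht, htu⟩ := hu
  obtain ⟨m, hm⟩ := hI.bddAbove
  refine ⟨m + 1, fun g hg => huU (htu fun i hi => ?_)⟩
  rw [hg i (Nat.lt_succ_of_le (hm hi))]
  exact mem_of_mem_nhds (ht i)

lemma exists_strictMono_ge (m : ℕ → ℕ) : ∃ h : ℕ → ℕ, StrictMono h ∧ ∀ n, m n ≤ h n := by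
  refine ⟨fun n => ∑ k ∈ Finset.range (n + 1), (m k + 1), strictMono_nat_of_lt_succ fun n => ?_,
    fun n => ?_⟩
  · rw [Finset.sum_range_succ _ (n + 1)]
    omega
  · dsimp only
    rw [Finset.sum_range_succ]
    omega

lemma ScheepersBounded.exists_abs_le {G : AddSubgroup (ℕ → ℤ)} (hG : ScheepersBounded G)
    (h : ℕ → ℕ) :
    ∃ f : ℕ → ℕ, ∀ F : Finset (ℕ → ℤ), (F : Set (ℕ → ℤ)) ⊆ (G : Set (ℕ → ℤ)) →
      ∃ n : ℕ, ∀ g ∈ F, ∀ i < h n, |g i| ≤ (f n : ℤ) := by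
  classical
  obtain ⟨A, hA⟩ := hG _ fun n => G.vanishing_mem_nhds_zero (h n)
  refine ⟨fun n => (A n).sup fun a => (Finset.range (h n)).sup fun i => ((a : ℕ → ℤ) i).natAbs,
    fun F hF => ?_⟩
  obtain ⟨n, hn⟩ := hA (F.subtype (· ∈ G))
  refine ⟨n, fun g hg i hi => ?_⟩
  obtain ⟨a, ha, u, hu, hau⟩ := hn (show (⟨g, hF hg⟩ : G) ∈ _ by simpa using hg)
  have hgi : g i = (a : ℕ → ℤ) i := by
    have h1 := congrArg (fun x : G => (x : ℕ → ℤ) i) hau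
    have h2 : (u : ℕ → ℤ) i = 0 := hu i hi
    simpa [h2] using h1.symm
  rw [hgi, Int.abs_eq_natAbs, Int.ofNat_le]
  exact (Finset.le_sup (f := fun i => ((a : ℕ → ℤ) i).natAbs) (Finset.mem_range.2 hi)).trans
    (Finset.le_sup
      (f := fun a : G => (Finset.range (h n)).sup fun i => ((a : ℕ → ℤ) i).natAbs) ha)

/-- Bounded initial segments of elements of `G` are represented by finitely many elements. -/
lemma AddSubgroup.exists_finset_representatives (G : AddSubgroup (ℕ → ℤ)) (N c : ℕ) :
    ∃ A : Finset G, ∀ g : G, (∀ i < N, |(g : ℕ → ℤ) i| ≤ (c : ℤ)) →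
      ∃ a ∈ A, ∀ i < N, (g : ℕ → ℤ) i = (a : ℕ → ℤ) i := by
  classical
  let r : G → Fin N → ℤ := fun g i => (g : ℕ → ℤ) i
  refine ⟨(Finset.Icc (fun _ => -(c : ℤ)) (fun _ => (c : ℤ))).image (Function.invFun r),
    fun g hg => ⟨Function.invFun r (r g), Finset.mem_image_of_mem _ ?_, fun i hi => ?_⟩⟩
  · exact Finset.mem_Icc.2 ⟨fun i => (abs_le.1 (hg i i.2)).1, fun i => (abs_le.1 (hg i i.2)).2⟩
  · exact (congrFun (Function.invFun_eq (f := r) ⟨g, rfl⟩) ⟨i, hi⟩).symm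

lemma ScheepersBounded.of_exists_abs_le {G : AddSubgroup (ℕ → ℤ)}
    (hG : ∀ h : ℕ → ℕ, StrictMono h → ∃ f : ℕ → ℕ,
      ∀ F : Finset (ℕ → ℤ), (F : Set (ℕ → ℤ)) ⊆ (G : Set (ℕ → ℤ)) →
        ∃ n : ℕ, ∀ g ∈ F, ∀ i < h n, |g i| ≤ (f n : ℤ)) :
    ScheepersBounded G := by
  classical
  intro U hU
  choose m hm using fun n => G.exists_vanishing_subset (hU n)
  obtain ⟨h, hh, hmh⟩ := exists_strictMono_ge m
  obtain ⟨f, hf⟩ := hG h hh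
  choose A hA using fun n => G.exists_finset_representatives (h n) (f n)
  refine ⟨A, fun E => ?_⟩
  obtain ⟨n, hn⟩ := hf (E.image Subtype.val) (by
    intro x hx
    obtain ⟨g, -, rfl⟩ := Finset.mem_image.1 hx
    exact g.2)
  refine ⟨n, fun g hg => ?_⟩
  obtain ⟨a, ha, hga⟩ := hA n g (hn g (Finset.mem_image_of_mem _ hg))
  refine ⟨a, ha, -a + g, hm n fun i hi => ?_, add_neg_cancel_left a g⟩
  simp [hga i (hi.trans_le (hmh n))]

/-- A bound for each shift of `h` gives a bound for `h` that works infinitely often. -/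
lemma exists_frequently_abs_le_of_exists {Y : Set (ℕ → ℤ)}
    (hY : ∀ h : ℕ → ℕ, StrictMono h → ∃ f : ℕ → ℕ,
      ∀ F : Finset (ℕ → ℤ), (F : Set (ℕ → ℤ)) ⊆ Y →
        ∃ n : ℕ, ∀ g ∈ F, ∀ i < h n, |g i| ≤ (f n : ℤ))
    (h : ℕ → ℕ) (hh : StrictMono h) :
    ∃ f : ℕ → ℕ, ∀ F : Finset (ℕ → ℤ), (F : Set (ℕ → ℤ)) ⊆ Y →
      ∃ᶠ n in atTop, ∀ g ∈ F, ∀ i < h n, |g i| ≤ (f n : ℤ) := by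
  choose f hf using fun k => hY (fun n => h (n + k)) fun a b hab => hh (by omega)
  refine ⟨fun n => (Finset.range (n + 1)).sup fun k => f k (n - k), fun F hF => ?_⟩
  refine frequently_atTop.2 fun N => ?_
  obtain ⟨n, hn⟩ := hf N F hF
  refine ⟨n + N, Nat.le_add_left N n, fun g hg i hi => (hn g hg i hi).trans ?_⟩
  rw [Int.ofNat_le]
  have hle := Finset.le_sup (f := fun k => f k (n + N - k))
    (Finset.mem_range.2 (show N < n + N + 1 by omega))
  simpa using hle

lemma exists_abs_le_of_frequently {Y : Set (ℕ → ℤ)}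
    (hY : ∃ f : ℕ → ℕ, ∀ F : Finset (ℕ → ℤ), (F : Set (ℕ → ℤ)) ⊆ Y →
      ∃ᶠ n in atTop, ∀ g ∈ F, ∀ i < n, |g i| ≤ (f n : ℤ))
    (h : ℕ → ℕ) (hh : StrictMono h) :
    ∃ f : ℕ → ℕ, ∀ F : Finset (ℕ → ℤ), (F : Set (ℕ → ℤ)) ⊆ Y →
      ∃ n : ℕ, ∀ g ∈ F, ∀ i < h n, |g i| ≤ (f n : ℤ) := by
  obtain ⟨f, hf⟩ := hY
  refine ⟨fun m => (Finset.range (h (m + 1))).sup f, fun F hF => ?_⟩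
  obtain ⟨n, hn, hb⟩ := frequently_atTop.1 (hf F hF) (h 0)
  obtain ⟨m, hm, hm'⟩ : ∃ m, h m ≤ n ∧ n < h (m + 1) := by
    by_contra! hcon
    have hall : ∀ m, h m ≤ n := fun m => Nat.rec hn hcon m
    exact absurd (hh.le_apply.trans (hall (n + 1))) (by omega)
  refine ⟨m, fun g hg i hi => (hb g hg i (hi.trans_le hm)).trans ?_⟩
  rw [Int.ofNat_le]
  exact Finset.le_sup (Finset.mem_range.2 hm')

theorem stmt_1 (G : AddSubgroup (ℕ → ℤ)) :
    List.TFAE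
      [ScheepersBounded ↥G,
       ∀ h : ℕ → ℕ, StrictMono h → ∃ f : ℕ → ℕ,
         ∀ F : Finset (ℕ → ℤ), (F : Set (ℕ → ℤ)) ⊆ (G : Set (ℕ → ℤ)) →
           ∃ n : ℕ, ∀ g ∈ F, ∀ i < h n, |g i| ≤ (f n : ℤ),
       ∀ h : ℕ → ℕ, StrictMono h → ∃ f : ℕ → ℕ,
         ∀ F : Finset (ℕ → ℤ), (F : Set (ℕ → ℤ)) ⊆ (G : Set (ℕ → ℤ)) →
           ∃ n : ℕ, ∀ g ∈ F, ∀ i < h n, g i ≤ (f n : ℤ),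
       ∃ f : ℕ → ℕ, ∀ F : Finset (ℕ → ℤ), (F : Set (ℕ → ℤ)) ⊆ (G : Set (ℕ → ℤ)) →
         ∃ᶠ n in atTop, ∀ g ∈ F, ∀ i < n, |g i| ≤ (f n : ℤ),
       ∃ f : ℕ → ℕ, ∀ F : Finset (ℕ → ℤ), (F : Set (ℕ → ℤ)) ⊆ (G : Set (ℕ → ℤ)) →
         ∃ᶠ n in atTop, ∀ g ∈ F, ∀ i < n, g i ≤ (f n : ℤ),
       ∀ h : ℕ → ℕ, StrictMono h → ∃ f : ℕ → ℕ,
         ∀ F : Finset (ℕ → ℤ), (F : Set (ℕ → ℤ)) ⊆ (G : Set (ℕ → ℤ)) →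
           ∃ᶠ n in atTop, ∀ g ∈ F, ∀ i < h n, |g i| ≤ (f n : ℤ),
       ∀ h : ℕ → ℕ, StrictMono h → ∃ f : ℕ → ℕ,
         ∀ F : Finset (ℕ → ℤ), (F : Set (ℕ → ℤ)) ⊆ (G : Set (ℕ → ℤ)) →
           ∃ᶠ n in atTop, ∀ g ∈ F, ∀ i < h n, g i ≤ (f n : ℤ)] := by
  tfae_have 1 → 2 := fun hG h _ => hG.exists_abs_le h
  tfae_have 2 → 1 := ScheepersBounded.of_exists_abs_le
  tfae_have 2 → 6 := exists_frequently_abs_le_of_exists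
  tfae_have 6 → 4 := fun H => H id strictMono_id
  tfae_have 4 → 2 := exists_abs_le_of_frequently
  tfae_have 4 → 5 := by
    rintro ⟨f, hf⟩
    exact ⟨f, fun F hF => (hf F hF).mono fun n hn g hg i hi => (le_abs_self _).trans (hn g hg i hi)⟩
  tfae_have 5 → 4 := by
    rintro ⟨f, hf⟩
    refine ⟨f, fun F hF => ?_⟩
    obtain ⟨F', hF', habs⟩ := G.exists_finset_abs_le_of_le F hF
    exact (hf F' hF').mono fun n hn => habs _ _ hn
  tfae_have 6 → 7 := by
    intro H h hh
    obtain ⟨f, hf⟩ := H h hh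
    exact ⟨f, fun F hF => (hf F hF).mono fun n hn g hg i hi => (le_abs_self _).trans (hn g hg i hi)⟩
  tfae_have 7 → 3 := by
    intro H h hh
    obtain ⟨f, hf⟩ := H h hh
    exact ⟨f, fun F hF => (hf F hF).exists⟩
  tfae_have 3 → 2 := by
    intro H h hh
    obtain ⟨f, hf⟩ := H h hh
    refine ⟨f, fun F hF => ?_⟩
    obtain ⟨F', hF', habs⟩ := G.exists_finset_abs_le_of_le F hF
    exact (hf F' hF').imp fun n hn => habs _ _ hn
  tfae_finish
end

section
/- There exists a subgroup G of the Baer–Specker group ℤ^ℕ such that G is Scheepers-bounded but G is not Hurewicz-bounded. -/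
open Filter Set Topology Pointwise

/-- The integer sequences whose initial segments of length `n` are bounded by a fixed multiple
of `n`, for `U`-almost all `n`. -/
def linearGrowthSubgroup (U : Filter ℕ) : AddSubgroup (ℕ → ℤ) where
  carrier := {g | ∃ k : ℕ, ∀ᶠ n in U, ∀ i < n, |g i| ≤ (k * n : ℕ)}
  zero_mem' := ⟨0, by simp⟩
  add_mem' := by
    rintro a b ⟨k, hk⟩ ⟨l, hl⟩
    refine ⟨k + l, ?_⟩
    filter_upwards [hk, hl] with n hk hl i hi
    have := abs_add_le (a i) (b i)
    have h₁ := hk i hi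
    have h₂ := hl i hi
    push_cast at *
    rw [Pi.add_apply, add_mul]
    linarith
  neg_mem' := by
    rintro a ⟨k, hk⟩
    exact ⟨k, by simpa using hk⟩

theorem exists_zero_on_initial_segment_mem {G : AddSubgroup (ℕ → ℤ)} {V : Set G}
    (hV : V ∈ nhds (0 : G)) : ∃ m : ℕ, ∀ x : G, (∀ i < m, (x : ℕ → ℤ) i = 0) → x ∈ V := by
  rw [nhds_subtype_eq_comap, mem_comap] at hV
  obtain ⟨W, hW, hWV⟩ := hV
  obtain ⟨O, hOW, hO, h0⟩ := mem_nhds_iff.1 hW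
  obtain ⟨I, u, hu, hIu⟩ := isOpen_pi_iff.1 hO _ h0
  refine ⟨I.sup id + 1, fun x hx => hWV (hOW (hIu fun i hi => ?_))⟩
  rw [hx i (Nat.lt_succ_of_le (Finset.le_sup (f := id) hi))]
  exact (hu i hi).2

theorem exists_finset_agreeing_on_initial_segment (G : AddSubgroup (ℕ → ℤ)) (m B : ℕ) :
    ∃ F : Finset G, ∀ x : G, (∀ i < m, |(x : ℕ → ℤ) i| ≤ B) →
      ∃ y ∈ F, ∀ i < m, (x : ℕ → ℤ) i = (y : ℕ → ℤ) i := by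
  classical
  let r : G → Fin m → ℤ := fun x i => (x : ℕ → ℤ) i
  refine ⟨(Finset.Icc (fun _ => -(B : ℤ)) (fun _ => (B : ℤ))).image (Function.invFun r),
    fun x hx => ⟨Function.invFun r (r x), Finset.mem_image_of_mem _ ?_, fun i hi => ?_⟩⟩
  · rw [Finset.mem_Icc]
    exact ⟨fun i => (abs_le.1 (hx i i.2)).1, fun i => (abs_le.1 (hx i i.2)).2⟩
  · have h : r (Function.invFun r (r x)) = r x := Function.invFun_eq ⟨x, rfl⟩
    exact (congrFun h ⟨i, hi⟩).symm

theorem scheepersBounded_linearGrowthSubgroup {U : Filter ℕ} [U.NeBot] (hU : U ≤ atTop) :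
    ScheepersBounded (linearGrowthSubgroup U) := by
  intro V hV
  choose m hm using fun n => exists_zero_on_initial_segment_mem (hV n)
  let M : ℕ → ℕ := fun n => n + ∑ j ∈ Finset.range (n + 1), m j
  have hmM : ∀ n, m n ≤ M n := fun n => by
    simp only [M, Finset.sum_range_succ]
    omega
  choose F hF using fun n =>
    exists_finset_agreeing_on_initial_segment (linearGrowthSubgroup U) (M n)
      (M (n + 1) * M (n + 1))
  refine ⟨F, fun E => ?_⟩
  have hE : ∀ᶠ N in U, ∀ x ∈ E, ∀ i < N, |(x : ℕ → ℤ) i| ≤ (N * N : ℕ) := by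
    rw [Filter.eventually_all_finset]
    intro x _
    obtain ⟨k, hk⟩ := x.2
    filter_upwards [hk, hU (eventually_ge_atTop k)] with N hN hkN i hi
    exact (hN i hi).trans (by exact_mod_cast Nat.mul_le_mul_right N hkN)
  obtain ⟨N, hN, hMN⟩ := (hE.and (hU (eventually_ge_atTop (M 0)))).exists
  have hex : ∃ l, N < M l := ⟨N + 1, by simp only [M]; omega⟩
  obtain ⟨n, hn, hn'⟩ : ∃ n, M n ≤ N ∧ N < M (n + 1) := by
    by_contra! h
    obtain ⟨l, hl⟩ := hex
    exact absurd hl (not_lt.2 (Nat.rec hMN h l))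
  refine ⟨n, fun x hx => ?_⟩
  obtain ⟨y, hy, hxy⟩ := hF n x fun i hi =>
    (hN x hx i (hi.trans_le hn)).trans (by exact_mod_cast Nat.mul_le_mul hn'.le hn'.le)
  refine Set.mem_add.2 ⟨y, hy, x - y, hm n _ fun i hi => ?_, add_sub_cancel y x⟩
  simp [hxy i (hi.trans_le (hmM n))]

theorem HurewiczBounded.hurewiczBddSet {G : AddSubgroup (ℕ → ℤ)} (hG : HurewiczBounded G) :
    HurewiczBddSet (G : Set (ℕ → ℤ)) := by
  obtain ⟨F, hF⟩ := hG (fun n => {x : G | (x : ℕ → ℤ) n = 0}) fun n =>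
    (isOpen_discrete {(0 : ℤ)}).preimage
      (show Continuous fun x : G => (x : ℕ → ℤ) n from
        (continuous_apply n).comp continuous_subtype_val) |>.mem_nhds rfl
  refine ⟨fun n => (F n).sup fun y => ((y : ℕ → ℤ) n).natAbs, fun g hg => ?_⟩
  filter_upwards [hF ⟨g, hg⟩] with n hn
  obtain ⟨y, hy, z, hz, hyz⟩ := Set.mem_add.1 hn
  have hgn : g n = (y : ℕ → ℤ) n := by
    have h := congrFun (congrArg Subtype.val hyz) n
    simpa [show (z : ℕ → ℤ) n = 0 from hz] using h.symm
  rw [hgn, Int.abs_eq_natAbs]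
  exact_mod_cast Finset.le_sup (f := fun y : G => ((y : ℕ → ℤ) n).natAbs) hy

theorem exists_mem_compl_intervals (U : Ultrafilter ℕ) {a : ℕ → ℕ} (ha : StrictMono a) :
    ∃ p < 2, ∀ᶠ n in U, ∀ k, k % 2 = p → a k ≤ n → a (k + 1) ≤ n := by
  have h : ∀ᶠ n in U, (∀ k, k % 2 = 0 → a k ≤ n → a (k + 1) ≤ n) ∨
      ∀ k, k % 2 = 1 → a k ≤ n → a (k + 1) ≤ n := by
    refine Eventually.of_forall fun n => ?_
    by_contra! ⟨⟨k, hk, hkn, hnk⟩, l, hl, hln, hnl⟩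
    have h₁ := ha.lt_iff_lt.1 (hkn.trans_lt hnl)
    have h₂ := ha.lt_iff_lt.1 (hln.trans_lt hnk)
    omega
  rcases Ultrafilter.eventually_or.1 h with h | h
  · exact ⟨0, by norm_num, h⟩
  · exact ⟨1, by norm_num, h⟩

theorem not_hurewiczBddSet_linearGrowthSubgroup (U : Ultrafilter ℕ) :
    ¬ HurewiczBddSet (linearGrowthSubgroup (U : Filter ℕ) : Set (ℕ → ℤ)) := by
  classical
  rintro ⟨f, hf⟩
  let a : ℕ → ℕ := fun k => (fun n => f n + n + 1)^[k] 0
  have hsucc : ∀ k, a (k + 1) = f (a k) + a k + 1 := fun k => Function.iterate_succ_apply' _ k 0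
  have ha : StrictMono a := strictMono_nat_of_lt_succ fun k => by rw [hsucc]; omega
  obtain ⟨p, hp, hU⟩ := exists_mem_compl_intervals U ha
  let g : ℕ → ℤ := fun i => if ∃ k : ℕ, k % 2 = p ∧ a k = i then (f i + i + 1 : ℕ) else 0
  have hg : g ∈ linearGrowthSubgroup (U : Filter ℕ) := by
    refine ⟨1, hU.mono fun n hn i hi => ?_⟩
    by_cases h : ∃ k, k % 2 = p ∧ a k = i
    · obtain ⟨k, hk, rfl⟩ := h
      have hgk : g (a k) = (a (k + 1) : ℕ) := by
        rw [hsucc]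
        exact if_pos ⟨k, hk, rfl⟩
      rw [hgk, Nat.abs_cast, one_mul]
      exact_mod_cast hn k hk hi.le
    · have hgi : g i = 0 := if_neg h
      rw [hgi, abs_zero]
      positivity
  obtain ⟨N, hN⟩ := eventually_atTop.1 (hf g hg)
  have hk : (2 * N + p) % 2 = p := by omega
  have h := hN (a (2 * N + p)) ((by omega : N ≤ 2 * N + p).trans ha.le_apply)
  have hgk : g (a (2 * N + p)) = (f (a (2 * N + p)) + a (2 * N + p) + 1 : ℕ) :=
    if_pos ⟨_, hk, rfl⟩
  rw [hgk, Nat.abs_cast] at h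
  norm_cast at h
  omega

theorem stmt_12 :
    ∃ G : AddSubgroup (ℕ → ℤ), ScheepersBounded ↥G ∧ ¬ HurewiczBounded ↥G :=
  ⟨linearGrowthSubgroup (hyperfilter ℕ),
    scheepersBounded_linearGrowthSubgroup Nat.hyperfilter_le_atTop,
    fun h => not_hurewiczBddSet_linearGrowthSubgroup (hyperfilter ℕ) h.hurewiczBddSet⟩
end

section
/- There exists a σ-compact subgroup H of the Baer–Specker group ℤ^ℕ and a subgroup G of H (so G is Hurewicz-bounded) such that G does not have the Menger property. -/
open Filter Set Topology Pointwise

/-- The subgroup of bounded sequences in the Baer–Specker group. -/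
def boundedSeq : AddSubgroup (ℕ → ℤ) where
  carrier := {x | ∃ n : ℕ, ∀ i, |x i| ≤ n}
  zero_mem' := ⟨0, fun i => by simp⟩
  add_mem' := by
    rintro x y ⟨m, hm⟩ ⟨n, hn⟩
    refine ⟨m + n, fun i => ?_⟩
    push_cast
    exact (abs_add_le _ _).trans (add_le_add (hm i) (hn i))
  neg_mem' := by
    rintro x ⟨m, hm⟩
    exact ⟨m, fun i => by simpa using hm i⟩

/-- The subgroup of sequences which, viewed as matrices through `Nat.pair`, have finitely supported
rows. -/
def finiteRows : AddSubgroup (ℕ → ℤ) where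
  carrier := {x | ∀ m, {k | x (Nat.pair m k) ≠ 0}.Finite}
  zero_mem' := fun m => by simp
  add_mem' := by
    intro x y hx hy m
    refine ((hx m).union (hy m)).subset fun k hk => ?_
    by_contra h
    simp only [mem_union, mem_ofPred_eq, not_or, not_not] at h
    exact hk (by simp [h.1, h.2])
  neg_mem' := by
    intro x hx m
    simpa using hx m

theorem isSigmaCompact_boundedSeq : IsSigmaCompact (boundedSeq : Set (ℕ → ℤ)) := by
  refine ⟨fun n : ℕ => univ.pi fun _ => Icc (-(n : ℤ)) n,
    fun n => isCompact_univ_pi fun _ => (finite_Icc _ _).isCompact, ?_⟩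
  ext x
  simp only [mem_iUnion, mem_univ_pi, mem_Icc, ← abs_le]
  rfl

/-- A neighborhood of zero contains every sequence with a long enough initial segment of zeros. -/
theorem exists_forall_lt_eq_zero_mem {G : AddSubgroup (ℕ → ℤ)} {U : Set G} (hU : U ∈ 𝓝 (0 : G)) :
    ∃ N : ℕ, ∀ g : G, (∀ i < N, (g : ℕ → ℤ) i = 0) → g ∈ U := by
  obtain ⟨V, hV, hVU⟩ := mem_nhds_subtype _ _ _ |>.1 hU
  rw [ZeroMemClass.coe_zero, nhds_pi, Filter.mem_pi] at hV
  obtain ⟨I, hI, t, ht, htV⟩ := hV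
  obtain ⟨N, hN⟩ := hI.bddAbove
  refine ⟨N + 1, fun g hg => hVU (htV fun i hi => ?_)⟩
  rw [hg i (Nat.lt_succ_of_le (hN hi))]
  exact mem_of_mem_nhds (ht i)

theorem exists_finset_add_of_abs_le {G : AddSubgroup (ℕ → ℤ)} {U : Set G} (hU : U ∈ 𝓝 (0 : G))
    (n : ℕ) : ∃ F : Finset G, ∀ g : G, (∀ i, |(g : ℕ → ℤ) i| ≤ n) → g ∈ (F : Set G) + U := by
  obtain ⟨N, hN⟩ := exists_forall_lt_eq_zero_mem hU
  let r : G → Fin N → ℤ := fun g i => (g : ℕ → ℤ) i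
  let s : Set G := {g | ∀ i, |(g : ℕ → ℤ) i| ≤ n}
  have hfin : (r '' s).Finite := by
    refine (Set.Finite.pi' fun _ : Fin N => finite_Icc (-(n : ℤ)) n).subset ?_
    rintro _ ⟨g, hg, rfl⟩ i
    exact abs_le.1 (hg i)
  obtain ⟨t, -, ht⟩ := exists_subset_bijOn s r
  have htfin : t.Finite := ht.finite_iff_finite.2 hfin
  refine ⟨htfin.toFinset, fun g hg => ?_⟩
  obtain ⟨f, hf, hfg⟩ := ht.surjOn (mem_image_of_mem r (show g ∈ s from hg))
  refine ⟨f, by simpa using hf, g - f, hN _ fun i hi => ?_, by simp⟩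
  have := congrFun hfg ⟨i, hi⟩
  simp only [r] at this
  simp [this]

theorem hurewiczBounded_of_le_boundedSeq {G : AddSubgroup (ℕ → ℤ)} (hG : G ≤ boundedSeq) :
    HurewiczBounded G := by
  intro U hU
  choose F hF using fun n => exists_finset_add_of_abs_le (hU n) n
  refine ⟨F, fun g => ?_⟩
  obtain ⟨m, hm⟩ := hG g.2
  filter_upwards [eventually_ge_atTop m] with n hn
  exact hF n g fun i => (hm i).trans (by exact_mod_cast hn)

theorem not_hasMenger_boundedSeq_inf_finiteRows :
    ¬ HasMenger ↥(boundedSeq ⊓ finiteRows : AddSubgroup (ℕ → ℤ)) := by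
  intro h
  let u : ℕ → ℕ → Set ↥(boundedSeq ⊓ finiteRows : AddSubgroup (ℕ → ℤ)) :=
    fun m k => {x | (x : ℕ → ℤ) (Nat.pair m k) = 0}
  have hopen : ∀ m, ∀ v ∈ range (u m), IsOpen v := by
    rintro m _ ⟨k, rfl⟩
    have hcont : Continuous fun x : ↥(boundedSeq ⊓ finiteRows : AddSubgroup (ℕ → ℤ)) =>
        (x : ℕ → ℤ) (Nat.pair m k) :=
      (continuous_apply (A := fun _ : ℕ => ℤ) (Nat.pair m k)).comp continuous_subtype_val
    exact (isOpen_discrete ({0} : Set ℤ)).preimage hcont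
  have hcover : ∀ m, ⋃₀ range (u m) = univ := by
    refine fun m => eq_univ_of_forall fun x => ?_
    obtain ⟨k, hk⟩ := (x.2.2 m).exists_notMem
    exact ⟨u m k, mem_range_self k, not_not.1 hk⟩
  obtain ⟨F, hF, hcov⟩ := h (fun m => range (u m)) hopen hcover
  have hK : ∀ m, ∃ K, ∀ v ∈ F m, ∃ k < K, u m k = v := by
    intro m
    choose! c hc using fun v (hv : v ∈ F m) => (hF m).2 hv
    obtain ⟨K, hK⟩ := ((hF m).1.image c).bddAbove
    exact ⟨K + 1, fun v hv => ⟨c v, Nat.lt_succ_of_le (hK (mem_image_of_mem c hv)), hc v hv⟩⟩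
  choose K hK using hK
  let x : ℕ → ℤ := fun i => if (Nat.unpair i).2 < K (Nat.unpair i).1 then 1 else 0
  have hx : x ∈ boundedSeq ⊓ finiteRows := by
    refine ⟨⟨1, fun i => ?_⟩, fun m => (finite_lt_nat (K m)).subset fun k hk => ?_⟩
    · simp only [x]
      split_ifs <;> simp
    · by_contra hkK
      exact hk (by simpa [x] using hkK)
  have hmem : (⟨x, hx⟩ : ↥(boundedSeq ⊓ finiteRows)) ∈ ⋃ n, ⋃₀ F n := hcov ▸ mem_univ _
  obtain ⟨m, v, hv, hxv⟩ := mem_iUnion.1 hmem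
  obtain ⟨k, hk, rfl⟩ := hK m v hv
  simp [u, x, hk] at hxv

theorem stmt_15 :
    ∃ H : AddSubgroup (ℕ → ℤ), IsSigmaCompact (H : Set (ℕ → ℤ)) ∧
      ∃ G : AddSubgroup (ℕ → ℤ), G ≤ H ∧ HurewiczBounded ↥G ∧ ¬ HasMenger ↥G := by
  exact ⟨boundedSeq, isSigmaCompact_boundedSeq, boundedSeq ⊓ finiteRows, inf_le_left,
    hurewiczBounded_of_le_boundedSeq inf_le_left, not_hasMenger_boundedSeq_inf_finiteRows⟩
end
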